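/- Let G be a group and {H_λ}_{λ∈Λ} a collection of subgroups of G, and suppose that G is finitely presented relative to {H_λ}_{λ∈Λ} with finite relative generating set X. Then: (1) there exists a finite subset Λ₀ = {λ₁, …, λ_m} ⊆ Λ such that G splits as the free product G = (∗_{λ∈Λ∖Λ₀} H_λ) ∗ G₀, where G₀ is the subgroup of G generated by H_{λ₁}, …, H_{λ_m} and X; (2) there exist finitely generated subgroups L_i ≤ H_{λ_i} (i = 1, …, m) and a finitely generated subgroup Q of G₀ containing all the L_i such that G₀ is isomorphic to the fundamental group of the star-shaped tree of groups with central vertex group Q, leaf vertex groups H_{λ₁}, …, H_{λ_m}, and edge groups L₁, …, L_m (each L_i embedded by inclusion into both Q and H_{λ_i}); moreover (a) Q is finitely presented relative to {L₁, …, L_m}, and (b) if the relative Dehn function δ^rel_G of G with respect to {H_λ}_{λ∈Λ} is well-defined, then the relative Dehn function δ^rel_Q of Q with respect to {L₁, …, L_m} is well-defined and δ^rel_Q ⪯ δ^rel_G ⪯ 𝛿̄^rel_Q, where 𝛿̄^rel_Q denotes the subnegative closure of δ^rel_Q. -/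

import Mathlib

namespace RelHyp

variable {G : Type*} [Group G] {Λ : Type*}

/-- Length of a shortest word over the alphabet `S ∪ S⁻¹` representing `g`. -/
noncomputable def wordLength (S : Set G) (g : G) : ℕ :=
  sInf {n | ∃ w : List G, w.length = n ∧ (∀ x ∈ w, x ∈ S ∨ x⁻¹ ∈ S) ∧ w.prod = g}

/-- The free product `F = (∗_λ H_λ) ∗ F(X)`. -/
abbrev RelFree (H : Λ → Subgroup G) (X : Set G) : Type _ :=
  Monoid.Coprod (Monoid.CoprodI fun l => ↥(H l)) (FreeGroup ↥X)

/-- The canonical homomorphism `ε : F → G`. -/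
def relEps (H : Λ → Subgroup G) (X : Set G) : RelFree H X →* G :=
  Monoid.Coprod.lift (Monoid.CoprodI.lift fun l => (H l).subtype)
    (FreeGroup.lift fun x => (x : G))

/-- Letters of the alphabet `X ∪ 𝓗`, where `𝓗 = ⊔_λ (H̃_λ ∖ {1})`. -/
abbrev RelLetter (H : Λ → Subgroup G) (X : Set G) : Type _ :=
  (Σ l : Λ, {h : ↥(H l) // h ≠ 1}) ⊕ (↥X × Bool)

/-- The image of a letter in the free product `F`. -/
def RelLetter.toF {H : Λ → Subgroup G} {X : Set G} : RelLetter H X → RelFree H X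
  | Sum.inl ⟨_, h⟩ => Monoid.Coprod.inl (Monoid.CoprodI.of h.1)
  | Sum.inr (x, b) => Monoid.Coprod.inr (if b then FreeGroup.of x else (FreeGroup.of x)⁻¹)

/-- The element of `G` represented by a letter. -/
def RelLetter.val {H : Λ → Subgroup G} {X : Set G} : RelLetter H X → G
  | Sum.inl ⟨_, h⟩ => (h.1 : G)
  | Sum.inr (x, b) => if b then (x : G) else (x : G)⁻¹

/-- The index `λ` such that the letter belongs to `H̃_λ`, if any. -/
def RelLetter.hIndex {H : Λ → Subgroup G} {X : Set G} : RelLetter H X → Option Λ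
  | Sum.inl ⟨l, _⟩ => some l
  | Sum.inr _ => none

/-- The element of `F` represented by a word over `X ∪ 𝓗`. -/
def wordToF {H : Λ → Subgroup G} {X : Set G} (w : List (RelLetter H X)) : RelFree H X :=
  (w.map RelLetter.toF).prod

/-- `f` is a relative isoperimetric function of the relative presentation `⟨X, H | R⟩`. -/
def IsIsoperFn (H : Λ → Subgroup G) (X : Set G) (R : Set (RelFree H X)) (f : ℕ → ℕ) : Prop :=
  ∀ w : List (RelLetter H X), relEps H X (wordToF w) = 1 →
    ∃ k ≤ f w.length, ∃ r c : Fin k → RelFree H X,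
      (∀ i, r i ∈ R) ∧ wordToF w = (List.ofFn fun i => (c i)⁻¹ * r i * c i).prod

/-- `⟨X, H | R⟩` is a finite relative presentation of `G` w.r.t. the collection `H`. -/
structure IsFiniteRelPres (H : Λ → Subgroup G) (X : Set G) (R : Set (RelFree H X)) : Prop where
  finX : X.Finite
  finR : R.Finite
  surj : Function.Surjective (relEps H X)
  ker : (relEps H X).ker = Subgroup.normalClosure R

/-- `G` is finitely presented relative to the collection of subgroups `H`. -/
def FinitelyPresentedRel (H : Λ → Subgroup G) : Prop :=
  ∃ (X : Set G) (R : Set (RelFree H X)), IsFiniteRelPres H X R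

/-- The relative area of a word representing `1`. -/
noncomputable def relArea (H : Λ → Subgroup G) (X : Set G) (R : Set (RelFree H X))
    (w : List (RelLetter H X)) : ℕ :=
  sInf {k | ∃ r c : Fin k → RelFree H X,
    (∀ i, r i ∈ R) ∧ wordToF w = (List.ofFn fun i => (c i)⁻¹ * r i * c i).prod}

/-- The relative Dehn function of the presentation `⟨X, H | R⟩`. -/
noncomputable def relDehn (H : Λ → Subgroup G) (X : Set G) (R : Set (RelFree H X))
    (n : ℕ) : ℕ :=
  sSup {a | ∃ w : List (RelLetter H X), w.length ≤ n ∧ relEps H X (wordToF w) = 1 ∧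
    a = relArea H X R w}

/-- The relative Dehn function is well-defined (finite for each value of the argument),
i.e. there exists a finite-valued relative isoperimetric function. -/
def DehnWellDefined (H : Λ → Subgroup G) (X : Set G) (R : Set (RelFree H X)) : Prop :=
  ∃ f : ℕ → ℕ, IsIsoperFn H X R f

/-- `f ⪯ g`. -/
def AsympLE (f g : ℕ → ℕ) : Prop := ∃ C K L : ℕ, ∀ n, f n ≤ C * g (K * n) + L * n

/-- `f ∼ g`. -/
def AsympEquiv (f g : ℕ → ℕ) : Prop := AsympLE f g ∧ AsympLE g f

/-- `G` is hyperbolic relative to `H`: it admits a finite relative presentation with a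
linear relative isoperimetric function. -/
def IsRelHyperbolic (H : Λ → Subgroup G) : Prop :=
  ∃ (X : Set G) (R : Set (RelFree H X)), IsFiniteRelPres H X R ∧
    ∃ A B : ℕ, IsIsoperFn H X R fun n => A * n + B

/-- The subnegative closure of `f`. -/
noncomputable def subnegClosure (f : ℕ → ℕ) (n : ℕ) : ℕ :=
  sSup {s | ∃ L : List ℕ, (∀ a ∈ L, 0 < a) ∧ L.sum = n ∧ s = (L.map f).sum}

/-- A combinatorial path in the Cayley graph `Γ(G, X ∪ 𝓗)`: a starting vertex
together with the word labelling the path. -/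
structure RelPath (H : Λ → Subgroup G) (X : Set G) where
  start : G
  word : List (RelLetter H X)

namespace RelPath

variable {H : Λ → Subgroup G} {X : Set G}

/-- The length of the path. -/
def len (p : RelPath H X) : ℕ := p.word.length

/-- The `k`-th vertex of the path. -/
def vertex (p : RelPath H X) (k : ℕ) : G :=
  p.start * ((p.word.take k).map RelLetter.val).prod

/-- The terminal vertex of the path. -/
def finish (p : RelPath H X) : G := p.vertex p.word.length

end RelPath

/-- The combinatorial metric `dist_{X ∪ 𝓗}` on `G`. -/
noncomputable def relDist (H : Λ → Subgroup G) (X : Set G) (g h : G) : ℕ :=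
  wordLength (X ∪ ⋃ l, (H l : Set G)) (g⁻¹ * h)

/-- The relative length `|g|_{X ∪ 𝓗}`. -/
noncomputable def relLen (H : Λ → Subgroup G) (X : Set G) (g : G) : ℕ :=
  wordLength (X ∪ ⋃ l, (H l : Set G)) g

/-- The word metric `dist_X` on `G`. -/
noncomputable def xDist (X : Set G) (g h : G) : ℕ := wordLength X (g⁻¹ * h)

variable {H : Λ → Subgroup G} {X : Set G}

/-- `p` is a `(λ, c)`-quasi-geodesic in `Γ(G, X ∪ 𝓗)`. -/
def IsQuasiGeodesic (lam c : ℝ) (p : RelPath H X) : Prop :=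
  ∀ i j : ℕ, i ≤ j → j ≤ p.len →
    ((j - i : ℕ) : ℝ) ≤ lam * (relDist H X (p.vertex i) (p.vertex j) : ℝ) + c

/-- `p` is a geodesic in `Γ(G, X ∪ 𝓗)`. -/
def IsGeodesic (p : RelPath H X) : Prop :=
  ∀ i j : ℕ, i ≤ j → j ≤ p.len → j - i = relDist H X (p.vertex i) (p.vertex j)

/-- The `k`-th letter of `p` is a letter of `H̃_l`. -/
def LetterIsH (p : RelPath H X) (l : Λ) (k : ℕ) : Prop :=
  ∃ a, p.word[k]? = some a ∧ a.hIndex = some l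

/-- The subpath of `p` consisting of the letters with indices `a, …, b` is an
`H_l`-component of `p` (a maximal nonempty `H_l`-subword). -/
def IsComponent (p : RelPath H X) (l : Λ) (a b : ℕ) : Prop :=
  a ≤ b ∧ b < p.len ∧ (∀ k, a ≤ k → k ≤ b → LetterIsH p l k) ∧
    (a = 0 ∨ ¬ LetterIsH p l (a - 1)) ∧ (b + 1 = p.len ∨ ¬ LetterIsH p l (b + 1))

/-- The `H_l`-components of `p` starting at index `a` and of `q` starting at `a'`
are connected (their vertices lie in the same left coset of `H_l`). -/
def ConnectedComp (p q : RelPath H X) (l : Λ) (a a' : ℕ) : Prop :=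
  (p.vertex a)⁻¹ * q.vertex a' ∈ H l

/-- `p` is a path without backtracking: all of its components are isolated. -/
def NoBacktracking (p : RelPath H X) : Prop :=
  ∀ l a b a' b', IsComponent p l a b → IsComponent p l a' b' →
    ConnectedComp p p l a a' → a = a' ∧ b = b'

/-- The `k`-th vertex of `p` is a phase vertex (not an inner vertex of a component). -/
def IsPhase (p : RelPath H X) (k : ℕ) : Prop :=
  ¬ ∃ l a b, IsComponent p l a b ∧ a < k ∧ k ≤ b

/-- `p` and `q` are `k`-similar: their endpoints are `X`-distance at most `k` apart. -/
def Similar (k : ℝ) (p q : RelPath H X) : Prop :=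
  (xDist X p.start q.start : ℝ) ≤ k ∧ (xDist X p.finish q.finish : ℝ) ≤ k

/-- The Rips thin-triangles condition for `Γ(G, X ∪ 𝓗)` with constant `δ`. -/
def RipsThin (H : Λ → Subgroup G) (X : Set G) (δ : ℝ) : Prop :=
  ∀ p q r : RelPath H X, IsGeodesic p → IsGeodesic q → IsGeodesic r →
    p.finish = q.start → q.finish = r.start → r.finish = p.start →
    ∀ i ≤ p.len, ∃ j : ℕ,
      (j ≤ q.len ∧ (relDist H X (p.vertex i) (q.vertex j) : ℝ) ≤ δ) ∨
      (j ≤ r.len ∧ (relDist H X (p.vertex i) (r.vertex j) : ℝ) ≤ δ)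

/-- The Cayley graph `Γ(G, X ∪ 𝓗)` is a hyperbolic metric space. -/
def CayleyHyperbolic (H : Λ → Subgroup G) (X : Set G) : Prop :=
  ∃ δ : ℝ, 0 ≤ δ ∧ RipsThin H X δ

/-- `R` is a relatively quasi-convex subgroup of `G`. -/
def RelQuasiconvex (H : Λ → Subgroup G) (X : Set G) (R : Subgroup G) : Prop :=
  ∃ σ : ℝ, 0 < σ ∧ ∀ p : RelPath H X, IsGeodesic p → p.start ∈ R → p.finish ∈ R →
    ∀ k ≤ p.len, ∃ w ∈ R, (xDist X (p.vertex k) w : ℝ) ≤ σ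

/-- `R` is a strongly relatively quasi-convex subgroup of `G`. -/
def StronglyRelQuasiconvex (H : Λ → Subgroup G) (X : Set G) (R : Subgroup G) : Prop :=
  RelQuasiconvex H X R ∧ ∀ (g : G) (l : Λ), {x : G | x ∈ R ∧ g * x * g⁻¹ ∈ H l}.Finite

/-- `g` is a hyperbolic element: it is not conjugate to an element of any `H_λ`. -/
def IsHypElt (H : Λ → Subgroup G) (g : G) : Prop :=
  ∀ l : Λ, ∀ x ∈ H l, ¬ IsConj g x

end RelHyp

open RelHyp

namespace RelHyp

open Monoid

section ConjProd

variable {F F' : Type*} [Group F] [Group F']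

/-- `f` is a product of at most `k` conjugates of elements of `R`. -/
def ConjProd (R : Set F) (k : ℕ) (f : F) : Prop :=
  ∃ p : List (F × F), p.length ≤ k ∧ (∀ q ∈ p, q.1 ∈ R) ∧
    f = (p.map fun q => q.2⁻¹ * q.1 * q.2).prod

theorem conjProd_iff_exists_fin {R : Set F} {k : ℕ} {f : F} :
    ConjProd R k f ↔ ∃ k' ≤ k, ∃ r c : Fin k' → F,
      (∀ i, r i ∈ R) ∧ f = (List.ofFn fun i => (c i)⁻¹ * r i * c i).prod := by
  constructor
  · rintro ⟨p, hp, hR, rfl⟩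
    refine ⟨p.length, hp, fun i => (p.get i).1, fun i => (p.get i).2,
      fun i => hR _ (p.get_mem i), ?_⟩
    conv_lhs => rw [← List.ofFn_get p, List.map_ofFn]
    rfl
  · rintro ⟨k', hk, r, c, hR, rfl⟩
    refine ⟨List.ofFn fun i => (r i, c i), by simpa using hk, ?_, ?_⟩
    · intro q hq
      obtain ⟨i, rfl⟩ := List.mem_ofFn.1 hq
      exact hR i
    · rw [List.map_ofFn]
      rfl

theorem ConjProd.mono {R : Set F} {k k' : ℕ} {f : F} (h : ConjProd R k f) (hk : k ≤ k') :
    ConjProd R k' f :=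
  let ⟨p, hp, h'⟩ := h
  ⟨p, hp.trans hk, h'⟩

theorem ConjProd.mul {R : Set F} {k k' : ℕ} {f f' : F} (h : ConjProd R k f)
    (h' : ConjProd R k' f') : ConjProd R (k + k') (f * f') := by
  obtain ⟨p, hp, hR, rfl⟩ := h
  obtain ⟨p', hp', hR', rfl⟩ := h'
  refine ⟨p ++ p', by simpa using add_le_add hp hp', fun q hq => ?_, by simp⟩
  rcases List.mem_append.1 hq with hq | hq
  exacts [hR q hq, hR' q hq]

theorem ConjProd.conj {R : Set F} {k : ℕ} {f : F} (h : ConjProd R k f) (c : F) :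
    ConjProd R k (c * f * c⁻¹) := by
  obtain ⟨p, hp, hR, rfl⟩ := h
  refine ⟨p.map fun q => (q.1, q.2 * c⁻¹), by simpa using hp, ?_, ?_⟩
  · intro q hq
    obtain ⟨q', hq', rfl⟩ := List.mem_map.1 hq
    exact hR q' hq'
  · clear hp hR
    induction p with
    | nil => simp
    | cons q p ih =>
      simp only [List.map_cons, List.prod_cons] at ih ⊢
      rw [← ih]
      group

theorem ConjProd.map {R : Set F} {R' : Set F'} (φ : F →* F') (hφ : ∀ r ∈ R, φ r ∈ R')
    {k : ℕ} {f : F} (h : ConjProd R k f) : ConjProd R' k (φ f) := by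
  obtain ⟨p, hp, hR, rfl⟩ := h
  refine ⟨p.map fun q => (φ q.1, φ q.2), by simpa using hp, ?_, ?_⟩
  · intro q hq
    obtain ⟨q', hq', rfl⟩ := List.mem_map.1 hq
    exact hφ _ (hR q' hq')
  · rw [map_list_prod, List.map_map, List.map_map]
    congr 2
    ext q
    simp

end ConjProd

section Words

variable {G : Type*} [Group G] {Λ : Type*} {H : Λ → Subgroup G} {X : Set G}

@[simp] theorem wordToF_nil : wordToF ([] : List (RelLetter H X)) = 1 := rfl

@[simp] theorem wordToF_cons (a : RelLetter H X) (w : List (RelLetter H X)) :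
    wordToF (a :: w) = a.toF * wordToF w := by
  simp [wordToF]

@[simp] theorem wordToF_append (w w' : List (RelLetter H X)) :
    wordToF (w ++ w') = wordToF w * wordToF w' := by
  simp [wordToF]

@[simp] theorem relEps_inl_of {l : Λ} (h : H l) :
    relEps H X (Coprod.inl (CoprodI.of (M := fun l => H l) h)) = h := by
  simp [relEps]

@[simp] theorem relEps_inr_of (x : X) : relEps H X (Coprod.inr (FreeGroup.of x)) = x := by
  simp [relEps]

@[simp] theorem relEps_toF (a : RelLetter H X) : relEps H X a.toF = a.val := by
  rcases a with ⟨l, h⟩ | ⟨x, _ | _⟩ <;> simp [RelLetter.toF, RelLetter.val]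

/-- The word of length at most one representing an element of a peripheral subgroup. -/
theorem exists_word_of (l : Λ) (h : H l) :
    ∃ w : List (RelLetter H X), w.length ≤ 1 ∧
      wordToF w = Coprod.inl (CoprodI.of (M := fun l => H l) h) ∧
      ∀ a ∈ w, ∃ h1 : h ≠ 1, a = Sum.inl ⟨l, h, h1⟩ := by
  by_cases h1 : h = 1
  · exact ⟨[], by simp [h1]⟩
  · exact ⟨[Sum.inl ⟨l, h, h1⟩], by simp [RelLetter.toF, h1]⟩

theorem wordToF_surjective : Function.Surjective (wordToF (H := H) (X := X)) := by
  have hmul : ∀ f f' : RelFree H X, (∃ w, wordToF w = f) → (∃ w, wordToF w = f') →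
      ∃ w, wordToF w = f * f' := by
    rintro _ _ ⟨w, rfl⟩ ⟨w', rfl⟩
    exact ⟨w ++ w', by simp⟩
  intro f
  induction f using Coprod.induction_on with
  | mul f f' h h' => exact hmul _ _ h h'
  | inl m =>
    induction m using CoprodI.induction_on with
    | one => exact ⟨[], by simp⟩
    | of l h =>
      obtain ⟨w, -, hw, -⟩ := exists_word_of (X := X) l h
      exact ⟨w, hw⟩
    | mul m m' h h' => simpa using hmul _ _ h h'
  | inr m =>
    induction m using FreeGroup.induction_on with
    | C1 => exact ⟨[], by simp⟩
    | of x => exact ⟨[Sum.inr (x, true)], by simp [RelLetter.toF]⟩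
    | inv_of x => exact ⟨[Sum.inr (x, false)], by simp [RelLetter.toF]⟩
    | mul m m' h h' => simpa using hmul _ _ h h'

theorem relFree_hom_ext {P : Type*} [Monoid P] {f g : RelFree H X →* P}
    (hH : ∀ l (h : H l), f (Coprod.inl (CoprodI.of (M := fun l => H l) h)) =
      g (Coprod.inl (CoprodI.of (M := fun l => H l) h)))
    (hX : ∀ x : X, f (Coprod.inr (FreeGroup.of x)) = g (Coprod.inr (FreeGroup.of x))) :
    f = g := by
  refine Coprod.hom_ext (CoprodI.ext_hom _ _ fun l => ?_) (FreeGroup.ext_hom _ _ ?_)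
  · ext h
    exact hH l h
  · exact hX

end Words

section Dehn

variable {G : Type*} [Group G] {Λ : Type*} {H : Λ → Subgroup G} {X : Set G}
  {R : Set (RelFree H X)}

theorem isIsoperFn_iff {f : ℕ → ℕ} : IsIsoperFn H X R f ↔
    ∀ w : List (RelLetter H X), relEps H X (wordToF w) = 1 →
      ConjProd R (f w.length) (wordToF w) := by
  simp only [conjProd_iff_exists_fin, IsIsoperFn]

theorem relArea_le {w : List (RelLetter H X)} {k : ℕ} (h : ConjProd R k (wordToF w)) :
    relArea H X R w ≤ k := by
  obtain ⟨k', hk, h⟩ := conjProd_iff_exists_fin.1 h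
  exact (Nat.sInf_le h).trans hk

theorem conjProd_relArea {w : List (RelLetter H X)} {k : ℕ} (h : ConjProd R k (wordToF w)) :
    ConjProd R (relArea H X R w) (wordToF w) := by
  obtain ⟨k', -, h⟩ := conjProd_iff_exists_fin.1 h
  have hmem : relArea H X R w ∈ {k | ∃ r c : Fin k → RelFree H X, (∀ i, r i ∈ R) ∧
      wordToF w = (List.ofFn fun i => (c i)⁻¹ * r i * c i).prod} := Nat.sInf_mem ⟨k', h⟩
  exact conjProd_iff_exists_fin.2 ⟨_, le_rfl, hmem⟩

theorem relDehn_le {n b : ℕ} (h : ∀ w : List (RelLetter H X), w.length ≤ n →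
    relEps H X (wordToF w) = 1 → relArea H X R w ≤ b) : relDehn H X R n ≤ b := by
  refine csSup_le' ?_
  rintro _ ⟨w, hw, h1, rfl⟩
  exact h w hw h1

theorem DehnWellDefined.relArea_le_relDehn (hD : DehnWellDefined H X R)
    {w : List (RelLetter H X)} (h1 : relEps H X (wordToF w) = 1) {n : ℕ} (hn : w.length ≤ n) :
    relArea H X R w ≤ relDehn H X R n := by
  obtain ⟨f, hf⟩ := hD
  refine le_csSup ⟨∑ i ∈ Finset.range (n + 1), f i, ?_⟩ ⟨w, hn, h1, rfl⟩
  rintro _ ⟨w, hw, h1, rfl⟩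
  exact (relArea_le (isIsoperFn_iff.1 hf w h1)).trans
    (Finset.single_le_sum (fun _ _ => Nat.zero_le _) (Finset.mem_range.2 (by omega)))

theorem DehnWellDefined.conjProd (hD : DehnWellDefined H X R)
    {w : List (RelLetter H X)} (h1 : relEps H X (wordToF w) = 1) {n : ℕ} (hn : w.length ≤ n) :
    ConjProd R (relDehn H X R n) (wordToF w) := by
  obtain ⟨f, hf⟩ := id hD
  exact (conjProd_relArea (isIsoperFn_iff.1 hf w h1)).mono (hD.relArea_le_relDehn h1 hn)

theorem DehnWellDefined.relDehn_mono (hD : DehnWellDefined H X R) :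
    Monotone (relDehn H X R) := fun _ _ hmn =>
  relDehn_le fun _ hw h1 => hD.relArea_le_relDehn h1 (hw.trans hmn)

theorem relDehn_zero : relDehn H X R 0 = 0 := by
  refine Nat.le_zero.1 (relDehn_le fun w hw _ => relArea_le ⟨[], le_rfl, by simp, ?_⟩)
  simp [List.length_eq_zero_iff.1 (Nat.le_zero.1 hw)]

theorem sum_map_le_subnegClosure {f : ℕ → ℕ} (hf : Monotone f) (h0 : f 0 = 0) {s : List ℕ}
    {n : ℕ} (hs : s.sum ≤ n) : (s.map f).sum ≤ subnegClosure f n := by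
  have hbdd : BddAbove {a | ∃ L : List ℕ, (∀ a ∈ L, 0 < a) ∧ L.sum = n ∧ a = (L.map f).sum} := by
    refine ⟨n * f n, ?_⟩
    rintro _ ⟨t, ht, rfl, rfl⟩
    have h1 : (t.map f).sum ≤ (t.map f).length • f t.sum := by
      refine List.sum_le_card_nsmul _ _ fun a ha => ?_
      obtain ⟨b, hb, rfl⟩ := List.mem_map.1 ha
      exact hf (List.single_le_sum (fun _ _ => Nat.zero_le _) _ hb)
    rw [List.length_map, smul_eq_mul] at h1
    exact h1.trans (Nat.mul_le_mul_right _ (List.length_le_sum_of_one_le _ ht))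
  have key : ∀ t : List ℕ, (t.filter (0 < ·)).sum = t.sum ∧
      ((t.filter (0 < ·)).map f).sum = (t.map f).sum := by
    intro t
    induction t with
    | nil => simp
    | cons a t ih =>
      rcases Nat.eq_zero_or_pos a with rfl | ha
      · simpa [h0] using ih
      · simpa [List.filter_cons_of_pos, ha] using ih
  have hle : (s.map f).sum ≤ ((s ++ [n - s.sum]).map f).sum := by simp
  refine hle.trans (le_csSup hbdd ⟨(s ++ [n - s.sum]).filter (0 < ·),
    fun a ha => by simpa using List.of_mem_filter ha, ?_, ?_⟩)
  · rw [(key _).1, List.sum_append, List.sum_singleton]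
    omega
  · rw [(key _).2]

end Dehn

section Cocycle

variable {G : Type*} [Group G] {Λ : Type*} {H : Λ → Subgroup G} {X : Set G}
  {A : Type*} [Group A]

/-- The action of `G` on functions `G → A` by right translation of the argument. -/
def translationAut (G A : Type*) [Group G] [Group A] : G →* MulAut (G → A) where
  toFun g :=
    { toFun := fun u x => u (x * g)
      invFun := fun u x => u (x * g⁻¹)
      left_inv := fun u => by simp
      right_inv := fun u => by simp
      map_mul' := fun _ _ => rfl }
  map_one' := by
    ext u x
    simp
  map_mul' g g' := by
    ext u x
    simp [mul_assoc]

/-- `κ` is a cocycle on the free product `F`, which acts on `G` by right translations. -/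
def IsCocycle (κ : RelFree H X → G → A) : Prop :=
  ∀ f f' x, κ (f * f') x = κ f x * κ f' (x * relEps H X f)

/-- A cocycle may be prescribed to be an arbitrary coboundary on each free factor `H_λ`, and
arbitrarily on the free generators. -/
theorem exists_isCocycle (φ : Λ → G → A) (ψ : X → G → A) :
    ∃ κ : RelFree H X → G → A, IsCocycle κ ∧
      (∀ l (h : H l) x, κ (Coprod.inl (CoprodI.of (M := fun l => H l) h)) x =
        (φ l x)⁻¹ * φ l (x * h)) ∧
      ∀ y x, κ (Coprod.inr (FreeGroup.of y)) x = ψ y x := by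
  let K : RelFree H X →* (G → A) ⋊[translationAut G A] G := Coprod.lift
    (CoprodI.lift fun l => (MulAut.conj (SemidirectProduct.inl (φ l)⁻¹)).toMonoidHom.comp
      ((SemidirectProduct.inr).comp (H l).subtype))
    (FreeGroup.lift fun y => ⟨ψ y, y⟩)
  have hK : ∀ f, (K f).right = relEps H X f := by
    have : (SemidirectProduct.rightHom : (G → A) ⋊[translationAut G A] G →* G).comp K =
        relEps H X := by
      refine relFree_hom_ext (fun l h => ?_) fun x => ?_
      · simp [K]
      · simp [K, SemidirectProduct.rightHom]
    exact fun f => DFunLike.congr_fun this f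
  refine ⟨fun f => (K f).left, fun f f' x => ?_, fun l h x => ?_, fun y x => ?_⟩
  · beta_reduce
    rw [← hK, map_mul]
    rfl
  · have h1 : K (Coprod.inl (CoprodI.of (M := fun l => H l) h)) =
        SemidirectProduct.inl (φ l)⁻¹ * SemidirectProduct.inr (h : G) *
          (SemidirectProduct.inl (φ l)⁻¹)⁻¹ := by
      rw [Coprod.lift_apply_inl, CoprodI.lift_of]
      rfl
    have h2 : (K (Coprod.inl (CoprodI.of (M := fun l => H l) h))).left =
        (φ l)⁻¹ * translationAut G A h (φ l) := by
      rw [h1]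
      simp
    exact congrFun h2 x
  · simp [K]

namespace IsCocycle

variable {κ : RelFree H X → G → A}

theorem map_one (hκ : IsCocycle κ) (x : G) : κ 1 x = 1 := by
  simpa using hκ 1 1 x

theorem map_inv (hκ : IsCocycle κ) (f : RelFree H X) (x : G) :
    κ f⁻¹ x = (κ f (x * (relEps H X f)⁻¹))⁻¹ := by
  have h := hκ f⁻¹ f x
  rw [inv_mul_cancel, hκ.map_one, _root_.map_inv] at h
  exact (inv_eq_of_mul_eq_one_left h.symm).symm

theorem map_conj (hκ : IsCocycle κ) (c r : RelFree H X) (hr : relEps H X r = 1) (x : G) :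
    κ (c⁻¹ * r * c) x = (κ c (x * (relEps H X c)⁻¹))⁻¹ * κ r (x * (relEps H X c)⁻¹) *
      κ c (x * (relEps H X c)⁻¹) := by
  rw [hκ, hκ, hκ.map_inv]
  simp [hr]

/-- A cocycle with values in a normal subgroup on the relators takes values in it on the
whole normal closure of the relators. -/
theorem mem_of_mem_normalClosure (hκ : IsCocycle κ) {R : Set (RelFree H X)}
    (hR : ∀ r ∈ R, relEps H X r = 1) {M : Subgroup A} [M.Normal]
    (hM : ∀ r ∈ R, ∀ x, κ r x ∈ M) {n : RelFree H X}
    (hn : n ∈ Subgroup.normalClosure R) : relEps H X n = 1 ∧ ∀ x, κ n x ∈ M := by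
  refine Subgroup.closure_induction (p := fun n _ => relEps H X n = 1 ∧ ∀ x, κ n x ∈ M)
    ?_ ?_ ?_ ?_ hn
  · intro n hn
    obtain ⟨r, hr, c, rfl⟩ : ∃ r ∈ R, ∃ c, c⁻¹ * r * c = n := by
      obtain ⟨r, hr, h⟩ := Group.mem_conjugatesOfSet_iff.1 hn
      obtain ⟨c, rfl⟩ := isConj_iff.1 h
      exact ⟨r, hr, c⁻¹, by simp⟩
    refine ⟨by simp [hR r hr], fun x => ?_⟩
    rw [hκ.map_conj c r (hR r hr)]
    simpa using ‹M.Normal›.conj_mem _ (hM r hr (x * (relEps H X c)⁻¹))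
      (κ c (x * (relEps H X c)⁻¹))⁻¹
  · exact ⟨by simp, fun x => by simp [hκ.map_one]⟩
  · rintro n n' - - ⟨h1, h⟩ ⟨h1', h'⟩
    refine ⟨by simp [h1, h1'], fun x => ?_⟩
    rw [hκ]
    exact M.mul_mem (h _) (h' _)
  · rintro n - ⟨h1, h⟩
    refine ⟨by simp [h1], fun x => ?_⟩
    rw [hκ.map_inv]
    exact M.inv_mem (h _)

end IsCocycle

end Cocycle

/-- A finite set of indices, subgroups `L l ≤ H l` which are trivial outside of this finite set,
and a subgroup `Q` containing `X` and all the `L l`. -/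
structure Core {G : Type*} [Group G] {Λ : Type*} (H : Λ → Subgroup G) (X : Set G) where
  /-- The finite set of indices of the factors that are not free factors. -/
  idx : Finset Λ
  /-- The edge groups. -/
  L : Λ → Subgroup G
  /-- The central vertex group. -/
  Q : Subgroup G
  L_le_H : ∀ l, L l ≤ H l
  L_le_Q : ∀ l, L l ≤ Q
  subset_Q : X ⊆ Q
  L_eq_bot : ∀ l ∉ idx, L l = ⊥

namespace Core

variable {G : Type*} [Group G] {Λ : Type*} {H : Λ → Subgroup G} {X : Set G} (C : Core H X)

/-- The edge groups as subgroups of the central vertex group. -/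
abbrev LQ (i : C.idx) : Subgroup C.Q := (C.L i.1).subgroupOf C.Q

/-- The set `X` as a subset of the central vertex group. -/
abbrev XQ : Set C.Q := {x | (x : G) ∈ X}

/-- The inclusion of an edge group into a leaf. -/
def toH (i : C.idx) : C.LQ i →* H i.1 :=
  (C.Q.subtype.comp (C.LQ i).subtype).codRestrict (H i.1)
    fun h => C.L_le_H i.1 (Subgroup.mem_subgroupOf.1 h.2)

@[simp] theorem coe_toH (i : C.idx) (h : C.LQ i) : (C.toH i h : G) = ((h : C.Q) : G) := rfl

/-- The embedding of the free product `(∗_i L_i) ∗ F(X)` into `(∗_l H_l) ∗ F(X)`. -/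
def emb : RelFree C.LQ C.XQ →* RelFree H X :=
  Coprod.lift
    (CoprodI.lift fun i => (Coprod.inl.comp (CoprodI.of (M := fun l => H l))).comp (C.toH i))
    (FreeGroup.lift fun x => Coprod.inr (FreeGroup.of ⟨((x : C.Q) : G), x.2⟩))

@[simp] theorem emb_inl_of (i : C.idx) (h : C.LQ i) :
    C.emb (Coprod.inl (CoprodI.of (M := fun i => C.LQ i) h)) =
      Coprod.inl (CoprodI.of (M := fun l => H l) (C.toH i h)) := by
  simp [emb]

@[simp] theorem emb_inr_of (x : C.XQ) :
    C.emb (Coprod.inr (FreeGroup.of x)) =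
      Coprod.inr (FreeGroup.of ⟨((x : C.Q) : G), x.2⟩) := by
  simp [emb]

theorem relEps_emb (a : RelFree C.LQ C.XQ) :
    relEps H X (C.emb a) = (relEps C.LQ C.XQ a : G) := by
  have : (relEps H X).comp C.emb = C.Q.subtype.comp (relEps C.LQ C.XQ) := by
    refine relFree_hom_ext (fun i h => ?_) fun x => ?_
    · simp
    · simp
  exact DFunLike.congr_fun this a

/-- The embedding of alphabets. -/
def letter : RelLetter C.LQ C.XQ → RelLetter H X
  | Sum.inl ⟨i, h⟩ => Sum.inl ⟨i.1, C.toH i h.1, fun h1 => h.2 (by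
      ext
      simpa using congrArg Subtype.val h1)⟩
  | Sum.inr (x, b) => Sum.inr (⟨((x : C.Q) : G), x.2⟩, b)

theorem emb_toF (a : RelLetter C.LQ C.XQ) : C.emb a.toF = (C.letter a).toF := by
  rcases a with ⟨i, h⟩ | ⟨x, _ | _⟩ <;> simp [RelLetter.toF, letter]

theorem emb_wordToF (w : List (RelLetter C.LQ C.XQ)) :
    C.emb (wordToF w) = wordToF (w.map C.letter) := by
  induction w with
  | nil => simp
  | cons a w ih => simp [emb_toF, ih]

/-- A letter that comes from the alphabet of the central vertex group. -/
def IsCentral : RelLetter H X → Prop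
  | Sum.inl ⟨l, h⟩ => (h.1 : G) ∈ C.L l
  | Sum.inr _ => True

theorem isCentral_letter (a : RelLetter C.LQ C.XQ) : C.IsCentral (C.letter a) := by
  rcases a with ⟨i, h⟩ | x
  · exact Subgroup.mem_subgroupOf.1 h.1.2
  · trivial

theorem exists_letter_eq {a : RelLetter H X} (ha : C.IsCentral a) : ∃ b, C.letter b = a := by
  rcases a with ⟨l, ⟨h, hH⟩, h1⟩ | ⟨⟨x, hx⟩, b⟩
  · have hL : h ∈ C.L l := ha
    have hl : l ∈ C.idx := by
      by_contra hl
      rw [C.L_eq_bot l hl, Subgroup.mem_bot] at hL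
      exact h1 (Subtype.ext hL)
    exact ⟨Sum.inl ⟨⟨l, hl⟩, ⟨⟨h, C.L_le_Q l hL⟩, Subgroup.mem_subgroupOf.2 hL⟩,
      fun h2 => h1 (Subtype.ext (congrArg (fun z : C.LQ ⟨l, hl⟩ => ((z : C.Q) : G)) h2))⟩, rfl⟩
  · exact ⟨Sum.inr (⟨⟨x, C.subset_Q hx⟩, hx⟩, b), rfl⟩

theorem exists_map_letter_eq {w : List (RelLetter H X)} (hw : ∀ a ∈ w, C.IsCentral a) :
    ∃ w' : List (RelLetter C.LQ C.XQ), w'.map C.letter = w := by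
  induction w with
  | nil => exact ⟨[], rfl⟩
  | cons a w ih =>
    obtain ⟨b, rfl⟩ := C.exists_letter_eq (hw a (by simp))
    obtain ⟨w', rfl⟩ := ih fun a ha => hw a (by simp [ha])
    exact ⟨b :: w', rfl⟩

section Retraction

theorem exists_coset_function {A : Type*} [Group A] (L : Subgroup G) (ι : L →* A) :
    ∃ φ : G → A, ∀ x (m : L), (φ x)⁻¹ * φ (x * m) = ι m := by
  have hmem : ∀ x : G, ((x : G ⧸ L).out)⁻¹ * x ∈ L := fun x =>
    QuotientGroup.eq.1 (QuotientGroup.out_eq' _)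
  refine ⟨fun x => ι ⟨_, hmem x⟩, fun x m => ?_⟩
  rw [← map_inv, ← map_mul]
  congr 1
  ext
  have : ((x * m : G) : G ⧸ L) = x := by simp
  simp [this]

/-- The inclusion of an edge group into the free product, the trivial map when the index is
outside of the finite set. -/
theorem exists_hom_edge (l : Λ) : ∃ ι : C.L l →* RelFree C.LQ C.XQ,
    ∀ (hl : l ∈ C.idx) (m : C.L l), ι m = Coprod.inl (CoprodI.of (M := fun i => C.LQ i)
      (i := ⟨l, hl⟩) ⟨⟨m, C.L_le_Q l m.2⟩, Subgroup.mem_subgroupOf.2 m.2⟩) := by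
  by_cases hl : l ∈ C.idx
  · exact ⟨(Coprod.inl.comp (CoprodI.of (M := fun i => C.LQ i) (i := ⟨l, hl⟩))).comp
      (Subgroup.subgroupOfEquivOfLe (C.L_le_Q l)).symm.toMonoidHom, fun _ _ => rfl⟩
  · exact ⟨1, fun h => absurd h hl⟩

open Classical in
/-- A cocycle on `F` extending the identity of the free product `(∗_i L_i) ∗ F(X)`. -/
theorem exists_retraction : ∃ κ : RelFree H X → G → RelFree C.LQ C.XQ, IsCocycle κ ∧
    ∀ a x, κ (C.emb a) x = if x ∈ C.Q then a else 1 := by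
  choose ι hι using C.exists_hom_edge
  choose φ hφ using fun l => exists_coset_function (C.L l) (ι l)
  obtain ⟨κ, hκ, hH, hX⟩ := exists_isCocycle (H := H) (X := X)
    (fun l x => if x ∈ C.Q then φ l x else 1)
    (fun y x => if x ∈ C.Q then
      Coprod.inr (FreeGroup.of (⟨⟨y, C.subset_Q y.2⟩, y.2⟩ : C.XQ)) else 1)
  refine ⟨κ, hκ, fun a x => ?_⟩
  have key : ∀ (b : RelLetter C.LQ C.XQ) (x : G),
      κ (C.emb b.toF) x = if x ∈ C.Q then b.toF else 1 := by
    intro b x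
    rcases b with ⟨i, h, h1⟩ | ⟨y, _ | _⟩
    · have hx : x * ((h : C.Q) : G) ∈ C.Q ↔ x ∈ C.Q := Subgroup.mul_mem_cancel_right _ h.1.2
      have := hφ i x ⟨((h : C.Q) : G), Subgroup.mem_subgroupOf.1 h.2⟩
      rw [hι i i.2] at this
      simp only [RelLetter.toF, emb_inl_of, hH, coe_toH, hx]
      split_ifs
      · exact this
      · simp
    · have hx : x * ((y : C.Q) : G)⁻¹ ∈ C.Q ↔ x ∈ C.Q :=
        Subgroup.mul_mem_cancel_right _ (inv_mem y.1.2)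
      simp only [RelLetter.toF, Bool.false_eq_true, if_false, map_inv, emb_inr_of, hκ.map_inv, hX,
        relEps_inr_of, hx]
      split_ifs <;> simp
    · simp [RelLetter.toF, hX]
  obtain ⟨w, rfl⟩ := wordToF_surjective a
  induction w generalizing x with
  | nil => simp [hκ.map_one]
  | cons b w ih =>
    have hx : x * ((relEps C.LQ C.XQ b.toF : C.Q) : G) ∈ C.Q ↔ x ∈ C.Q :=
      Subgroup.mul_mem_cancel_right _ (Subtype.prop _)
    rw [wordToF_cons, map_mul, hκ, ih, key, relEps_emb]
    simp only [hx]
    split_ifs <;> simp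

theorem emb_injective : Function.Injective C.emb := by
  classical
  obtain ⟨κ, -, h⟩ := C.exists_retraction
  intro a b hab
  simpa [h] using congrArg (fun f => κ f 1) hab

variable {R : Set (RelFree H X)}

theorem conjProd_of_emb (hR : R ⊆ Set.range C.emb) (hR1 : ∀ r ∈ R, relEps H X r = 1)
    {k : ℕ} {a : RelFree C.LQ C.XQ} (h : ConjProd R k (C.emb a)) :
    ConjProd (C.emb ⁻¹' R) k a := by
  classical
  obtain ⟨κ, hκ, hemb⟩ := C.exists_retraction
  obtain ⟨p, hp, hpR, ha⟩ := h
  have key : ∀ p : List (RelFree H X × RelFree H X), (∀ q ∈ p, q.1 ∈ R) →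
      relEps H X (p.map fun q => q.2⁻¹ * q.1 * q.2).prod = 1 ∧
      ConjProd (C.emb ⁻¹' R) p.length (κ (p.map fun q => q.2⁻¹ * q.1 * q.2).prod 1) := by
    intro p hp
    induction p with
    | nil => exact ⟨by simp, [], by simp, by simp, by simp [hκ.map_one]⟩
    | cons q p ih =>
      obtain ⟨ih1, ih2⟩ := ih fun q hq => hp q (by simp [hq])
      have hq := hp q (by simp)
      have hq1 : relEps H X (q.2⁻¹ * q.1 * q.2) = 1 := by simp [hR1 _ hq]
      refine ⟨by rw [List.map_cons, List.prod_cons, map_mul, hq1, ih1, one_mul], ?_⟩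
      rw [List.map_cons, List.prod_cons, hκ, hq1, mul_one, List.length_cons, add_comm]
      refine ConjProd.mul ?_ ih2
      rw [hκ.map_conj _ _ (hR1 _ hq)]
      obtain ⟨b, hb⟩ := hR hq
      rw [← hb, hemb]
      split_ifs
      · exact ⟨[(b, κ q.2 (1 * (relEps H X q.2)⁻¹))], by simp, by simpa [hb] using hq, by simp⟩
      · exact ⟨[], by simp, by simp, by simp⟩
  have h1 : κ (C.emb a) 1 = a := by simp [hemb]
  rw [← h1, ha]
  exact (key p hpR).2.mono hp

theorem isFiniteRelPres (hpres : IsFiniteRelPres H X R) (hR : R ⊆ Set.range C.emb)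
    (hQ : C.Q = Subgroup.closure (X ∪ ⋃ l, (C.L l : Set G))) :
    IsFiniteRelPres C.LQ C.XQ (C.emb ⁻¹' R) := by
  classical
  have hR1 : ∀ r ∈ R, relEps H X r = 1 := fun r hr => by
    rw [← MonoidHom.mem_ker, hpres.ker]
    exact Subgroup.subset_normalClosure hr
  have hle : Subgroup.normalClosure (C.emb ⁻¹' R) ≤ (relEps C.LQ C.XQ).ker := by
    refine Subgroup.normalClosure_le_normal fun a ha => ?_
    rw [SetLike.mem_coe, MonoidHom.mem_ker, ← Subtype.val_inj, ← relEps_emb]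
    exact hR1 _ ha
  refine ⟨hpres.finX.preimage Subtype.val_injective.injOn,
    hpres.finR.preimage C.emb_injective.injOn, ?_, le_antisymm (fun a ha => ?_) hle⟩
  · have : C.Q ≤ ((C.Q.subtype).comp (relEps C.LQ C.XQ)).range := by
      conv_lhs => rw [hQ]
      rw [Subgroup.closure_le, Set.union_subset_iff, Set.iUnion_subset_iff]
      constructor
      · intro x hx
        exact ⟨Coprod.inr (FreeGroup.of ⟨⟨x, C.subset_Q hx⟩, hx⟩), by simp⟩
      · intro l x hx
        by_cases hl : l ∈ C.idx
        · exact ⟨Coprod.inl (CoprodI.of (M := fun i => C.LQ i) (i := ⟨l, hl⟩)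
            ⟨⟨x, C.L_le_Q l hx⟩, Subgroup.mem_subgroupOf.2 hx⟩), by simp⟩
        · rw [C.L_eq_bot l hl] at hx
          rw [Subgroup.mem_bot.1 hx]
          exact one_mem _
    rintro ⟨q, hq⟩
    obtain ⟨a, ha⟩ := this hq
    exact ⟨a, Subtype.ext ha⟩
  · obtain ⟨κ, hκ, hemb⟩ := C.exists_retraction
    have hn : C.emb a ∈ Subgroup.normalClosure R := by
      rw [← hpres.ker, MonoidHom.mem_ker, relEps_emb, MonoidHom.mem_ker.1 ha]
      rfl
    have := (hκ.mem_of_mem_normalClosure (M := Subgroup.normalClosure (C.emb ⁻¹' R)) hR1 ?_ hn).2 1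
    · simpa [hemb] using this
    · intro r hr x
      obtain ⟨b, rfl⟩ := hR hr
      rw [hemb]
      split_ifs
      · exact Subgroup.subset_normalClosure hr
      · exact one_mem _

end Retraction

section Descent

variable {R : Set (RelFree H X)} {P : Type*} [Group P]

/-- A homomorphism of `F` that factors through `Q` on the central part descends to `G`. -/
theorem exists_descent (hpres : IsFiniteRelPres H X R) (hR : R ⊆ Set.range C.emb)
    (Ψ : RelFree H X →* P) (θ : C.Q →* P)
    (hH : ∀ l (h : H l) (hL : (h : G) ∈ C.L l),
      Ψ (Coprod.inl (CoprodI.of (M := fun l => H l) h)) = θ ⟨h, C.L_le_Q l hL⟩)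
    (hX : ∀ x : X, Ψ (Coprod.inr (FreeGroup.of x)) = θ ⟨x, C.subset_Q x.2⟩) :
    ∃ Φ : G →* P, (∀ l (h : H l), Φ h = Ψ (Coprod.inl (CoprodI.of (M := fun l => H l) h))) ∧
      (∀ x : X, Φ x = Ψ (Coprod.inr (FreeGroup.of x))) := by
  have hemb : ∀ a, Ψ (C.emb a) = θ (relEps C.LQ C.XQ a) := by
    have : Ψ.comp C.emb = θ.comp (relEps C.LQ C.XQ) := by
      refine relFree_hom_ext (fun i h => ?_) fun x => ?_
      · simpa using hH i (C.toH i h) (Subgroup.mem_subgroupOf.1 h.2)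
      · simpa using hX ⟨_, x.2⟩
    exact fun a => DFunLike.congr_fun this a
  have hker : (relEps H X).ker ≤ Ψ.ker := by
    rw [hpres.ker]
    refine Subgroup.normalClosure_le_normal fun r hr => ?_
    have hr1 : relEps H X r = 1 := by
      rw [← MonoidHom.mem_ker, hpres.ker]
      exact Subgroup.subset_normalClosure hr
    obtain ⟨a, rfl⟩ := hR hr
    rw [SetLike.mem_coe, MonoidHom.mem_ker, hemb]
    rw [relEps_emb, OneMemClass.coe_eq_one] at hr1
    rw [hr1, map_one]
  have hΦ := (relEps H X).liftOfRightInverse_comp_apply _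
    (Function.rightInverse_surjInv hpres.surj) ⟨Ψ, hker⟩
  refine ⟨(relEps H X).liftOfRightInverse _ (Function.rightInverse_surjInv hpres.surj) ⟨Ψ, hker⟩,
    fun l h => ?_, fun x => ?_⟩
  · simpa using hΦ (Coprod.inl (CoprodI.of (M := fun l => H l) h))
  · simpa using hΦ (Coprod.inr (FreeGroup.of x))

end Descent

section Reduction

open Classical in
/-- The edge of the Bass–Serre tree crossed by a letter read at `x`, as a pair of half-edges;
central letters cross no edge. -/
noncomputable def edge (x : G) : RelLetter H X → List ((Σ l, G ⧸ C.L l) × Bool)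
  | Sum.inl ⟨l, h⟩ => if (h.1 : G) ∈ C.L l then [] else
      [(⟨l, (x : G ⧸ C.L l)⟩, true), (⟨l, ((x * h.1 : G) : G ⧸ C.L l)⟩, false)]
  | Sum.inr _ => []

/-- The sequence of half-edges crossed by a word read from `x`. -/
noncomputable def edges : G → List (RelLetter H X) → List ((Σ l, G ⧸ C.L l) × Bool)
  | _, [] => []
  | x, a :: w => C.edge x a ++ edges (x * a.val) w

theorem edge_of_isCentral (x : G) {a : RelLetter H X} (ha : C.IsCentral a) : C.edge x a = [] := by
  rcases a with ⟨l, h⟩ | a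
  · exact if_pos ha
  · rfl

theorem edge_of_not_mem (x : G) {l : Λ} {h : {h : H l // h ≠ 1}} (hh : (h.1 : G) ∉ C.L l) :
    C.edge x (Sum.inl ⟨l, h⟩ : RelLetter H X) =
      [(⟨l, (x : G ⧸ C.L l)⟩, true), (⟨l, ((x * h.1 : G) : G ⧸ C.L l)⟩, false)] :=
  if_neg hh

theorem edges_central_append {u : List (RelLetter H X)} (hu : ∀ a ∈ u, C.IsCentral a) (x : G)
    (w : List (RelLetter H X)) :
    C.edges x (u ++ w) = C.edges (x * relEps H X (wordToF u)) w := by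
  induction u generalizing x with
  | nil => simp
  | cons a u ih =>
    rw [List.cons_append, edges, C.edge_of_isCentral x (hu a (by simp)), List.nil_append,
      ih fun b hb => hu b (by simp [hb])]
    simp [mul_assoc]

theorem edges_of_central {u : List (RelLetter H X)} (hu : ∀ a ∈ u, C.IsCentral a) (x : G) :
    C.edges x u = [] := by
  simpa [edges] using C.edges_central_append hu x []

theorem isCentral_of_edges_eq_nil {w : List (RelLetter H X)} {x : G} (hw : C.edges x w = []) :
    ∀ a ∈ w, C.IsCentral a := by
  induction w generalizing x with
  | nil => simp
  | cons a w ih =>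
    rw [edges, List.append_eq_nil_iff] at hw
    refine List.forall_mem_cons.2 ⟨?_, ih hw.2⟩
    rcases a with ⟨l, h⟩ | a
    · by_contra hh
      exact List.cons_ne_nil _ _ ((C.edge_of_not_mem x hh).symm.trans hw.1)
    · trivial

theorem forall_isCentral_or_exists_split (w : List (RelLetter H X)) :
    (∀ a ∈ w, C.IsCentral a) ∨ ∃ u l, ∃ h : {h : H l // h ≠ 1}, ∃ w', (h.1 : G) ∉ C.L l ∧
      (∀ a ∈ u, C.IsCentral a) ∧ w = u ++ Sum.inl ⟨l, h⟩ :: w' := by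
  induction w with
  | nil => simp
  | cons a w ih =>
    by_cases ha : C.IsCentral a
    · rcases ih with h | ⟨u, l, h, w', hh, hu, rfl⟩
      · exact Or.inl (List.forall_mem_cons.2 ⟨ha, h⟩)
      · exact Or.inr ⟨a :: u, l, h, w', hh, List.forall_mem_cons.2 ⟨ha, hu⟩, rfl⟩
    · rcases a with ⟨l, h⟩ | a
      · exact Or.inr ⟨[], l, h, w, ha, by simp, rfl⟩
      · exact absurd trivial ha

/-- A word whose sequence of half-edges is not reduced has a central subword which represents
an element of `L l` and whose neighbours are letters from `H l`. -/
theorem isReduced_edges_or_exists (w : List (RelLetter H X)) (x : G) :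
    FreeGroup.IsReduced (C.edges x w) ∨ ∃ w₁ l, ∃ h h' : {h : H l // h ≠ 1}, ∃ u w₂,
      w = w₁ ++ Sum.inl ⟨l, h⟩ :: (u ++ Sum.inl ⟨l, h'⟩ :: w₂) ∧ (∀ a ∈ u, C.IsCentral a) ∧
        relEps H X (wordToF u) ∈ C.L l := by
  induction w generalizing x with
  | nil => exact Or.inl FreeGroup.IsReduced.nil
  | cons a w ih =>
    rcases ih (x * a.val) with hred | ⟨w₁, l, h, h', u, w₂, rfl, hu⟩
    swap
    · exact Or.inr ⟨a :: w₁, l, h, h', u, w₂, rfl, hu⟩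
    by_cases ha : C.IsCentral a
    · left
      rwa [edges, C.edge_of_isCentral x ha, List.nil_append]
    rcases a with ⟨l, h⟩ | a
    swap
    · exact absurd trivial ha
    have hne : (x : G ⧸ C.L l) ≠ ((x * h.1 : G) : G ⧸ C.L l) := fun e =>
      ha (by simpa [IsCentral] using QuotientGroup.eq.1 e)
    rw [edges, C.edge_of_not_mem x ha, List.cons_append, List.cons_append, List.nil_append,
      FreeGroup.isReduced_cons_cons]
    have h0 : (⟨l, (x : G ⧸ C.L l)⟩ : Σ l, G ⧸ C.L l) ≠ ⟨l, ((x * h.1 : G) : G ⧸ C.L l)⟩ :=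
      fun e => hne (eq_of_heq (Sigma.mk.inj e).2)
    rcases C.forall_isCentral_or_exists_split w with hw | ⟨u, l', h', w', hh', hu, rfl⟩
    · left
      rw [C.edges_of_central hw]
      exact ⟨fun e => absurd e h0, FreeGroup.IsReduced.singleton⟩
    rw [C.edges_central_append hu, edges, C.edge_of_not_mem _ hh'] at hred ⊢
    by_cases he : (⟨l, ((x * h.1 : G) : G ⧸ C.L l)⟩ : Σ l, G ⧸ C.L l) =
        ⟨l', ((x * h.1 * relEps H X (wordToF u) : G) : G ⧸ C.L l')⟩
    · right
      obtain rfl : l = l' := congrArg Sigma.fst he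
      refine ⟨[], l, h, h', u, w', rfl, hu, ?_⟩
      simpa [mul_assoc] using QuotientGroup.eq.1 (eq_of_heq (Sigma.mk.inj he).2)
    · left
      refine ⟨fun e => absurd e h0, ?_⟩
      rw [List.cons_append, FreeGroup.isReduced_cons_cons]
      exact ⟨fun e => absurd e he, hred⟩

/-- The sequence of half-edges of a word that represents the identity is trivial in the free
group. -/
theorem mk_edges_eq_one {R : Set (RelFree H X)} (hpres : IsFiniteRelPres H X R)
    (hR : R ⊆ Set.range C.emb) {w : List (RelLetter H X)} (h1 : relEps H X (wordToF w) = 1)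
    (x : G) : FreeGroup.mk (C.edges x w) = 1 := by
  obtain ⟨κ, hκ, hH, hX⟩ := exists_isCocycle (H := H) (X := X)
    (fun l x => (FreeGroup.of (⟨l, (x : G ⧸ C.L l)⟩ : Σ l, G ⧸ C.L l))⁻¹) (fun _ _ => 1)
  have hedge : ∀ (a : RelLetter H X) x, κ a.toF x = FreeGroup.mk (C.edge x a) := by
    intro a x
    by_cases ha : C.IsCentral a
    · rw [C.edge_of_isCentral x ha]
      rcases a with ⟨l, h⟩ | ⟨y, _ | _⟩
      · have : ((x * h.1 : G) : G ⧸ C.L l) = x := by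
          simpa using QuotientGroup.mk_mul_of_mem x ha
        simp only [RelLetter.toF, hH, this, inv_inv, mul_inv_cancel]
        rfl
      · simp only [RelLetter.toF, Bool.false_eq_true, if_false, map_inv, hκ.map_inv, hX, inv_one]
        rfl
      · simp only [RelLetter.toF, if_true, hX]
        rfl
    · rcases a with ⟨l, h⟩ | a
      · rw [C.edge_of_not_mem x ha]
        simp only [RelLetter.toF, hH, inv_inv]
        rfl
      · exact absurd trivial ha
  have hedges : ∀ (w : List (RelLetter H X)) x,
      κ (wordToF w) x = FreeGroup.mk (C.edges x w) := by
    intro w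
    induction w with
    | nil => exact fun x => hκ.map_one x
    | cons a w ih =>
      intro x
      rw [wordToF_cons, hκ, hedge, ih, relEps_toF, edges, FreeGroup.mul_mk]
  have hR1 : ∀ r ∈ R, relEps H X r = 1 := fun r hr => by
    rw [← MonoidHom.mem_ker, hpres.ker]
    exact Subgroup.subset_normalClosure hr
  rw [← MonoidHom.mem_ker, hpres.ker] at h1
  have := (hκ.mem_of_mem_normalClosure (M := ⊥) hR1 (fun r hr y => ?_) h1).2 x
  · rwa [hedges, Subgroup.mem_bot] at this
  · obtain ⟨b, rfl⟩ := hR hr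
    obtain ⟨v, rfl⟩ := wordToF_surjective b
    rw [emb_wordToF, hedges, C.edges_of_central fun a ha => ?_]
    · exact one_mem _
    · obtain ⟨b, -, rfl⟩ := List.mem_map.1 ha
      exact C.isCentral_letter b

variable {R : Set (RelFree H X)}

theorem conjProd_of_central (hD : DehnWellDefined C.LQ C.XQ (C.emb ⁻¹' R))
    {w : List (RelLetter H X)} (hw : ∀ a ∈ w, C.IsCentral a) (h1 : relEps H X (wordToF w) = 1)
    {n : ℕ} (hn : w.length ≤ n) :
    ConjProd R (relDehn C.LQ C.XQ (C.emb ⁻¹' R) n) (wordToF w) := by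
  obtain ⟨v, rfl⟩ := C.exists_map_letter_eq hw
  rw [← emb_wordToF] at h1 ⊢
  rw [relEps_emb, OneMemClass.coe_eq_one] at h1
  exact (hD.conjProd h1 (by simpa using hn)).map C.emb fun _ hr => hr

theorem exists_conjProd_sum (hpres : IsFiniteRelPres H X R) (hR : R ⊆ Set.range C.emb)
    (hD : DehnWellDefined C.LQ C.XQ (C.emb ⁻¹' R)) (w : List (RelLetter H X))
    (h1 : relEps H X (wordToF w) = 1) :
    ∃ s : List ℕ, s.sum ≤ w.length ∧
      ConjProd R (s.map (relDehn C.LQ C.XQ (C.emb ⁻¹' R))).sum (wordToF w) := by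
  classical
  induction hn : w.length using Nat.strong_induction_on generalizing w with
  | _ n ih =>
  subst hn
  rcases C.isReduced_edges_or_exists w 1 with hred | ⟨w₁, l, h, h', u, w₂, rfl, hu, hm⟩
  · have hnil : C.edges 1 w = [] := by
      rw [← hred.reduce_eq, ← FreeGroup.toWord_mk, C.mk_edges_eq_one hpres hR h1,
        FreeGroup.toWord_one]
    exact ⟨[w.length], by simp, by
      simpa using C.conjProd_of_central hD (C.isCentral_of_edges_eq_nil hnil) h1 le_rfl⟩
  · set m : H l := ⟨_, C.L_le_H l hm⟩
    obtain ⟨v, hv, hvF, hvL⟩ := exists_word_of (X := X) l m⁻¹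
    obtain ⟨z, hz, hzF, -⟩ := exists_word_of (X := X) l (h.1 * m * h'.1)
    have huv1 : relEps H X (wordToF (u ++ v)) = 1 := by
      rw [wordToF_append, hvF, map_mul, relEps_inl_of]
      exact mul_inv_cancel _
    have huv := C.conjProd_of_central hD (w := u ++ v) (n := u.length + 1) (fun a ha => by
      rcases List.mem_append.1 ha with ha | ha
      · exact hu a ha
      · obtain ⟨_, rfl⟩ := hvL a ha
        exact inv_mem hm) huv1 (by simpa using hv)
    have hW : wordToF (w₁ ++ Sum.inl ⟨l, h⟩ :: (u ++ Sum.inl ⟨l, h'⟩ :: w₂)) =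
        wordToF (w₁ ++ [Sum.inl ⟨l, h⟩]) * wordToF (u ++ v) *
          (wordToF (w₁ ++ [Sum.inl ⟨l, h⟩]))⁻¹ * wordToF (w₁ ++ (z ++ w₂)) := by
      simp only [wordToF_append, wordToF_cons, wordToF_nil, hvF, hzF, RelLetter.toF, map_mul,
        map_inv]
      group
    have hz1 : relEps H X (wordToF (w₁ ++ (z ++ w₂))) = 1 := by
      rw [hW] at h1
      simpa only [map_mul, huv1, mul_one, map_inv, mul_inv_cancel, one_mul] using h1
    obtain ⟨s, hs, hsc⟩ := ih (w₁ ++ (z ++ w₂)).length (by simp; omega) _ hz1 rfl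
    refine ⟨(u.length + 1) :: s, ?_, ?_⟩
    · simp only [List.sum_cons, List.length_append, List.length_cons] at hs ⊢
      omega
    · rw [hW, List.map_cons, List.sum_cons]
      exact (huv.conj _).mul hsc

end Reduction

section Dehn

variable {R : Set (RelFree H X)}

theorem conjProd_wordToF (hR : R ⊆ Set.range C.emb) (hpres : IsFiniteRelPres H X R)
    (hD : DehnWellDefined H X R) {w : List (RelLetter C.LQ C.XQ)}
    (h1 : relEps C.LQ C.XQ (wordToF w) = 1) {n : ℕ} (hn : w.length ≤ n) :
    ConjProd (C.emb ⁻¹' R) (relDehn H X R n) (wordToF w) := by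
  refine C.conjProd_of_emb hR (fun r hr => ?_) ?_
  · rw [← MonoidHom.mem_ker, hpres.ker]
    exact Subgroup.subset_normalClosure hr
  · rw [emb_wordToF]
    refine hD.conjProd ?_ (by simpa using hn)
    rw [← emb_wordToF, relEps_emb, h1, OneMemClass.coe_one]

theorem dehnWellDefined (hR : R ⊆ Set.range C.emb) (hpres : IsFiniteRelPres H X R)
    (hD : DehnWellDefined H X R) : DehnWellDefined C.LQ C.XQ (C.emb ⁻¹' R) :=
  ⟨relDehn H X R, isIsoperFn_iff.2 fun _ h1 => C.conjProd_wordToF hR hpres hD h1 le_rfl⟩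

theorem relDehn_le_relDehn (hR : R ⊆ Set.range C.emb) (hpres : IsFiniteRelPres H X R)
    (hD : DehnWellDefined H X R) (n : ℕ) :
    relDehn C.LQ C.XQ (C.emb ⁻¹' R) n ≤ relDehn H X R n :=
  relDehn_le fun _ hw h1 => relArea_le (C.conjProd_wordToF hR hpres hD h1 hw)

theorem relDehn_le_subnegClosure (hR : R ⊆ Set.range C.emb) (hpres : IsFiniteRelPres H X R)
    (hD : DehnWellDefined C.LQ C.XQ (C.emb ⁻¹' R)) (n : ℕ) :
    relDehn H X R n ≤ subnegClosure (relDehn C.LQ C.XQ (C.emb ⁻¹' R)) n :=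
  relDehn_le fun w hw h1 =>
    let ⟨_, hs, hsc⟩ := C.exists_conjProd_sum hpres hR hD w h1
    (relArea_le hsc).trans
      (sum_map_le_subnegClosure hD.relDehn_mono relDehn_zero (hs.trans hw))

end Dehn

section Splitting

variable {R : Set (RelFree H X)}

theorem eq_of_eqOn_generators {P : Type*} [Group P] {K : Subgroup G} {S : Set G}
    (hK : K = Subgroup.closure S) {f g : K →* P}
    (h : ∀ x (hx : x ∈ K), x ∈ S → f ⟨x, hx⟩ = g ⟨x, hx⟩) : f = g := by
  subst hK
  exact MonoidHom.eq_of_eqOn_dense Subgroup.closure_closure_coe_preimage fun x hx => h x x.2 hx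

/-- The vertex group `G₀`, generated by `X` and the finitely many subgroups `H l` which are not
free factors. -/
abbrev base : Subgroup G := Subgroup.closure (X ∪ ⋃ l ∈ C.idx, (H l : Set G))

theorem H_le_base {l : Λ} (hl : l ∈ C.idx) : H l ≤ C.base := fun _ hx =>
  Subgroup.subset_closure (Or.inr (Set.mem_biUnion hl hx))

theorem subset_base : X ⊆ C.base := Set.subset_union_left.trans Subgroup.subset_closure

theorem Q_le_base (hQ : C.Q = Subgroup.closure (X ∪ ⋃ l, (C.L l : Set G))) : C.Q ≤ C.base := by
  rw [hQ, Subgroup.closure_le, Set.union_subset_iff, Set.iUnion_subset_iff]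
  refine ⟨C.subset_base, fun l x hx => ?_⟩
  by_cases hl : l ∈ C.idx
  · exact C.H_le_base hl (C.L_le_H l hx)
  · rw [C.L_eq_bot l hl] at hx
    rw [Subgroup.mem_bot.1 hx]
    exact one_mem _

theorem bijective_lift_base (hpres : IsFiniteRelPres H X R) (hR : R ⊆ Set.range C.emb)
    (hQ : C.Q = Subgroup.closure (X ∪ ⋃ l, (C.L l : Set G))) :
    Function.Bijective (Coprod.lift
      (CoprodI.lift fun l : {l : Λ // l ∉ C.idx} => (H l.1).subtype) C.base.subtype) := by
  classical
  have hι : ∀ l, ∃ ι : H l →* Coprod (CoprodI fun l : {l : Λ // l ∉ C.idx} => H l.1) C.base,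
      (∀ (hl : l ∈ C.idx) h, ι h = Coprod.inr ⟨h, C.H_le_base hl h.2⟩) ∧
      ∀ (hl : l ∉ C.idx) h, ι h = Coprod.inl (CoprodI.of
        (M := fun l : {l : Λ // l ∉ C.idx} => H l.1) (i := ⟨l, hl⟩) h) := by
    intro l
    by_cases hl : l ∈ C.idx
    · exact ⟨Coprod.inr.comp (Subgroup.inclusion (C.H_le_base hl)), fun _ _ => rfl,
        fun hl' => absurd hl hl'⟩
    · exact ⟨Coprod.inl.comp (CoprodI.of (M := fun l : {l : Λ // l ∉ C.idx} => H l.1)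
        (i := ⟨l, hl⟩)), fun hl' => absurd hl' hl, fun _ _ => rfl⟩
  choose ι hι₁ hι₂ using hι
  obtain ⟨Φ, hΦH, hΦX⟩ := C.exists_descent hpres hR
    (Coprod.lift (CoprodI.lift ι) (FreeGroup.lift fun x => Coprod.inr ⟨x, C.subset_base x.2⟩))
    (Coprod.inr.comp (Subgroup.inclusion (C.Q_le_base hQ))) (fun l h hL => by
      rw [Coprod.lift_apply_inl, CoprodI.lift_of]
      by_cases hl : l ∈ C.idx
      · exact hι₁ l hl h
      · rw [C.L_eq_bot l hl, Subgroup.mem_bot, OneMemClass.coe_eq_one] at hL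
        subst hL
        rw [map_one]
        exact (map_one _).symm) (fun x => by simp [Subgroup.inclusion])
  simp only [Coprod.lift_apply_inl, CoprodI.lift_of] at hΦH
  simp only [Coprod.lift_apply_inr, FreeGroup.lift_apply_of] at hΦX
  constructor
  · refine Function.LeftInverse.injective (g := Φ) fun y => ?_
    refine DFunLike.congr_fun (?_ : Φ.comp (Coprod.lift _ _) = MonoidHom.id _) y
    refine Coprod.hom_ext (CoprodI.ext_hom _ _ fun l => ?_)
      (eq_of_eqOn_generators rfl fun x hx hxS => ?_)
    · ext h
      simpa using (hΦH l h).trans (hι₂ l l.2 h)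
    · simp only [MonoidHom.comp_apply, Coprod.lift_apply_inr, Subgroup.coe_subtype,
        MonoidHom.id_apply]
      rcases hxS with hxX | hxH
      · exact hΦX ⟨x, hxX⟩
      · obtain ⟨l, hl, hxl⟩ := Set.mem_iUnion₂.1 hxH
        exact (hΦH l ⟨x, hxl⟩).trans (hι₁ l hl _)
  · have hfac : relEps H X = (Coprod.lift
        (CoprodI.lift fun l : {l : Λ // l ∉ C.idx} => (H l.1).subtype) C.base.subtype).comp
        (Coprod.lift (CoprodI.lift ι)
          (FreeGroup.lift fun x : X => Coprod.inr ⟨x, C.subset_base x.2⟩)) := by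
      refine relFree_hom_ext (fun l h => ?_) fun x => ?_
      · by_cases hl : l ∈ C.idx
        · simp [hι₁ l hl]
        · simp [hι₂ l hl]
      · simp
    have := hpres.surj
    rw [hfac, MonoidHom.coe_comp] at this
    exact this.of_comp

/-- The relations identifying the two copies of each edge group. -/
abbrev amalgamRel : Set (Coprod C.Q (CoprodI fun i : C.idx => H i.1)) :=
  {y | ∃ (i : C.idx) (x : G) (hx : x ∈ C.L i.1), y = Coprod.inl (⟨x, C.L_le_Q i.1 hx⟩ : C.Q) *
    (Coprod.inr (CoprodI.of (M := fun j : C.idx => H j.1) (i := i)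
      ⟨x, C.L_le_H i.1 hx⟩))⁻¹}

theorem nonempty_base_mulEquiv (hpres : IsFiniteRelPres H X R) (hR : R ⊆ Set.range C.emb)
    (hQ : C.Q = Subgroup.closure (X ∪ ⋃ l, (C.L l : Set G))) :
    Nonempty (C.base ≃* Coprod C.Q (CoprodI fun i : C.idx => H i.1) ⧸
      Subgroup.normalClosure C.amalgamRel) := by
  classical
  set N := Subgroup.normalClosure C.amalgamRel
  have hrel : ∀ (i : C.idx) (x : G) (hx : x ∈ C.L i.1),
      QuotientGroup.mk' N (Coprod.inr (CoprodI.of (M := fun j : C.idx => H j.1) (i := i)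
        ⟨x, C.L_le_H i.1 hx⟩)) = QuotientGroup.mk' N (Coprod.inl ⟨x, C.L_le_Q i.1 hx⟩) := by
    intro i x hx
    refine (mul_inv_eq_one.1 ?_).symm
    rw [← map_inv, ← map_mul]
    exact (QuotientGroup.eq_one_iff _).2 (Subgroup.subset_normalClosure ⟨i, x, hx, rfl⟩)
  have hι : ∀ l, ∃ ι : H l →* Coprod C.Q (CoprodI fun i : C.idx => H i.1) ⧸ N,
      (∀ (hl : l ∈ C.idx) h, ι h = QuotientGroup.mk' N (Coprod.inr (CoprodI.of
        (M := fun j : C.idx => H j.1) (i := ⟨l, hl⟩) h))) ∧ (l ∉ C.idx → ι = 1) := by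
    intro l
    by_cases hl : l ∈ C.idx
    · exact ⟨(QuotientGroup.mk' N).comp (Coprod.inr.comp (CoprodI.of
        (M := fun j : C.idx => H j.1) (i := ⟨l, hl⟩))), fun _ _ => rfl, fun hl' => absurd hl hl'⟩
    · exact ⟨1, fun hl' => absurd hl' hl, fun _ => rfl⟩
  choose ι hι₁ hι₂ using hι
  obtain ⟨Φ, hΦH, hΦX⟩ := C.exists_descent hpres hR
    (Coprod.lift (CoprodI.lift ι) (FreeGroup.lift fun x =>
      QuotientGroup.mk' N (Coprod.inl ⟨x, C.subset_Q x.2⟩)))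
    ((QuotientGroup.mk' N).comp Coprod.inl) (fun l h hL => by
      rw [Coprod.lift_apply_inl, CoprodI.lift_of]
      by_cases hl : l ∈ C.idx
      · exact (hι₁ l hl h).trans (hrel ⟨l, hl⟩ h hL)
      · rw [C.L_eq_bot l hl, Subgroup.mem_bot, OneMemClass.coe_eq_one] at hL
        subst hL
        rw [map_one]
        exact (map_one _).symm) (fun x => by simp)
  simp only [Coprod.lift_apply_inl, CoprodI.lift_of] at hΦH
  simp only [Coprod.lift_apply_inr, FreeGroup.lift_apply_of] at hΦX
  let T : Coprod C.Q (CoprodI fun i : C.idx => H i.1) ⧸ N →* C.base :=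
    QuotientGroup.lift N (Coprod.lift (Subgroup.inclusion (C.Q_le_base hQ))
      (CoprodI.lift fun i => Subgroup.inclusion (C.H_le_base i.2))) <|
      Subgroup.normalClosure_le_normal (N := MonoidHom.ker _) <| by
        rintro _ ⟨i, x, hx, rfl⟩
        rw [SetLike.mem_coe, MonoidHom.mem_ker, map_mul, map_inv, mul_inv_eq_one]
        simp [Subgroup.inclusion]
  have hTQ : ∀ q : C.Q, T (QuotientGroup.mk' N (Coprod.inl q)) = ⟨q, C.Q_le_base hQ q.2⟩ :=
    fun q => by simp [T, Subgroup.inclusion]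
  have hTH : ∀ (i : C.idx) (h : H i.1), T (QuotientGroup.mk' N (Coprod.inr (CoprodI.of
      (M := fun j : C.idx => H j.1) (i := i) h))) = ⟨h, C.H_le_base i.2 h.2⟩ :=
    fun i h => by simp [T, Subgroup.inclusion]
  refine ⟨MonoidHom.toMulEquiv (Φ.comp C.base.subtype) T ?_ ?_⟩
  · refine eq_of_eqOn_generators rfl fun x hx hxS => ?_
    simp only [MonoidHom.comp_apply, Subgroup.coe_subtype, MonoidHom.id_apply]
    rcases hxS with hxX | hxH
    · rw [hΦX ⟨x, hxX⟩, hTQ]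
    · obtain ⟨l, hl, hxl⟩ := Set.mem_iUnion₂.1 hxH
      rw [hΦH l ⟨x, hxl⟩, hι₁ l hl, hTH]
  · refine QuotientGroup.monoidHom_ext N (Coprod.hom_ext
      (eq_of_eqOn_generators hQ fun x hx hxS => ?_) (CoprodI.ext_hom _ _ fun i => ?_))
    · simp only [MonoidHom.comp_apply]
      rw [hTQ, Subgroup.coe_subtype]
      rcases hxS with hxX | hxL
      · exact hΦX ⟨x, hxX⟩
      · obtain ⟨l, hxl⟩ := Set.mem_iUnion.1 hxL
        by_cases hl : l ∈ C.idx
        · exact (hΦH l ⟨x, C.L_le_H l hxl⟩).trans ((hι₁ l hl _).trans (hrel ⟨l, hl⟩ x hxl))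
        · rw [C.L_eq_bot l hl] at hxl
          obtain rfl := Subgroup.mem_bot.1 hxl
          exact (map_one Φ).trans (map_one ((QuotientGroup.mk' N).comp Coprod.inl)).symm
    · ext h
      simp only [MonoidHom.comp_apply]
      rw [hTH, Subgroup.coe_subtype]
      exact (hΦH i h).trans (hι₁ i i.2 h)

end Splitting

section Existence

/-- The letters occurring in the relators of a finite relative presentation generate the edge
groups of the splitting. -/
theorem _root_.RelHyp.exists_core {R : Set (RelFree H X)} (hpres : IsFiniteRelPres H X R) :
    ∃ C : Core H X, R ⊆ Set.range C.emb ∧ (∀ l, (C.L l).FG) ∧ C.Q.FG ∧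
      C.Q = Subgroup.closure (X ∪ ⋃ l, (C.L l : Set G)) := by
  classical
  choose W hW using wordToF_surjective (H := H) (X := X)
  have hfin : {p : Σ l, {h : H l // h ≠ 1} | ∃ r ∈ R, Sum.inl p ∈ W r}.Finite := by
    have := hpres.finR.biUnion fun r _ => (W r).finite_toSet
    refine (this.preimage Sum.inl_injective.injOn).subset ?_
    rintro p ⟨r, hr, hp⟩
    exact Set.mem_biUnion hr hp
  set T := hfin.toFinset
  let S : Λ → Finset G := fun l => (T.filter fun p => p.1 = l).image fun p => (p.2.1 : G)
  have hSH : ∀ l, (S l : Set G) ⊆ H l := by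
    intro l x hx
    obtain ⟨p, hp, rfl⟩ := Finset.mem_image.1 (Finset.mem_coe.1 hx)
    obtain rfl := (Finset.mem_filter.1 hp).2
    exact p.2.1.2
  have hbot : ∀ l ∉ T.image Sigma.fst, Subgroup.closure (S l : Set G) = ⊥ := by
    intro l hl
    rw [Subgroup.closure_eq_bot_iff]
    intro x hx
    obtain ⟨p, hp, rfl⟩ := Finset.mem_image.1 (Finset.mem_coe.1 hx)
    obtain ⟨hpT, rfl⟩ := Finset.mem_filter.1 hp
    exact absurd (Finset.mem_image_of_mem Sigma.fst hpT) hl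
  let C : Core H X :=
    { idx := T.image Sigma.fst
      L := fun l => Subgroup.closure (S l)
      Q := Subgroup.closure (X ∪ ⋃ l, (Subgroup.closure (S l : Set G) : Set G))
      L_le_H := fun l => (Subgroup.closure_le _).2 (hSH l)
      L_le_Q := fun l _ hx => Subgroup.subset_closure (Or.inr (Set.mem_iUnion.2 ⟨l, hx⟩))
      subset_Q := fun _ hx => Subgroup.subset_closure (Or.inl hx)
      L_eq_bot := hbot }
  refine ⟨C, fun r hr => ?_, fun l => ⟨S l, rfl⟩, ?_, rfl⟩
  · obtain ⟨v, hv⟩ := C.exists_map_letter_eq (w := W r) fun a ha => by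
      rcases a with ⟨l, h⟩ | a
      · exact Subgroup.subset_closure (Finset.mem_image.2 ⟨⟨l, h⟩,
          Finset.mem_filter.2 ⟨hfin.mem_toFinset.2 ⟨r, hr, ha⟩, rfl⟩, rfl⟩)
      · trivial
    exact ⟨wordToF v, by rw [emb_wordToF, hv, hW]⟩
  · have hQ : C.Q = Subgroup.closure (X ∪ ⋃ l, (S l : Set G)) := by
      simp only [C, Subgroup.closure_union, Subgroup.closure_iUnion, Subgroup.closure_eq]
    refine (Subgroup.fg_iff _).2 ⟨_, hQ.symm, hpres.finX.union ?_⟩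
    refine (T.image fun p => (p.2.1 : G)).finite_toSet.subset (Set.iUnion_subset fun l => ?_)
    exact Finset.coe_subset.2 (Finset.image_subset_image (Finset.filter_subset _ _))

end Existence

end Core

end RelHyp

/-- Theorem 2.44, the Splitting Theorem. If `G` is finitely presented relative
to `{H_λ}_{λ∈Λ}` with finite relative generating set `X`, then there is a finite `Λ₀ ⊆ Λ` such
that, with `G₀ = ⟨X ∪ ⋃_{λ∈Λ₀} H_λ⟩`, the canonical map `(∗_{λ∉Λ₀} H_λ) ∗ G₀ → G` is an
isomorphism; moreover there are finitely generated subgroups `L_i ≤ H_{λ_i}` and a finitely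
generated subgroup `Q ≤ G₀` containing all the `L_i` such that `G₀` is isomorphic to the
fundamental group of the star-shaped tree of groups with central vertex `Q`, leaves `H_{λ_i}`
and edge groups `L_i` (realized as the quotient of `Q ∗ (∗_i H_{λ_i})` by the relations
identifying the two copies of each `L_i`); furthermore (a) `Q` is finitely presented relative to
`{L₁,…,L_m}`, and (b) if the relative Dehn function of `G` is well-defined then so is that of
`Q`, and `δ^rel_Q ⪯ δ^rel_G ⪯ (δ^rel_Q)‾` (subnegative closure). -/
theorem statement_5 {G : Type*} [Group G] {Λ : Type*} (H : Λ → Subgroup G)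
    (X : Set G) (R : Set (RelFree H X)) (hpres : IsFiniteRelPres H X R) :
    ∃ Λ₀ : Finset Λ,
      Function.Bijective
        (Monoid.Coprod.lift
          (Monoid.CoprodI.lift fun l : {l : Λ // l ∉ Λ₀} => (H l.1).subtype)
          (Subgroup.closure (X ∪ ⋃ l ∈ Λ₀, (H l : Set G))).subtype) ∧
      ∃ (L : ↥Λ₀ → Subgroup G) (Q : Subgroup G)
        (hLH : ∀ i : ↥Λ₀, L i ≤ H i.1) (hLQ : ∀ i : ↥Λ₀, L i ≤ Q),
        (∀ i, (L i).FG) ∧ Q.FG ∧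
        Q ≤ Subgroup.closure (X ∪ ⋃ l ∈ Λ₀, (H l : Set G)) ∧
        Nonempty
          (↥(Subgroup.closure (X ∪ ⋃ l ∈ Λ₀, (H l : Set G))) ≃*
            (Monoid.Coprod ↥Q (Monoid.CoprodI fun i : ↥Λ₀ => ↥(H i.1)) ⧸
              Subgroup.normalClosure
                {y | ∃ (i : ↥Λ₀) (x : G) (hx : x ∈ L i),
                  y = Monoid.Coprod.inl (⟨x, hLQ i hx⟩ : ↥Q) *
                      (Monoid.Coprod.inr
                        (Monoid.CoprodI.of (M := fun j : ↥Λ₀ => ↥(H j.1)) (i := i)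
                          ⟨x, hLH i hx⟩))⁻¹})) ∧
        FinitelyPresentedRel (fun i : ↥Λ₀ => (L i).subgroupOf Q) ∧
        (DehnWellDefined H X R →
          ∃ (XQ : Set ↥Q) (RQ : Set (RelFree (fun i : ↥Λ₀ => (L i).subgroupOf Q) XQ)),
            IsFiniteRelPres (fun i : ↥Λ₀ => (L i).subgroupOf Q) XQ RQ ∧
            DehnWellDefined (fun i : ↥Λ₀ => (L i).subgroupOf Q) XQ RQ ∧
            AsympLE (relDehn (fun i : ↥Λ₀ => (L i).subgroupOf Q) XQ RQ) (relDehn H X R) ∧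
            AsympLE (relDehn H X R)
              (subnegClosure (relDehn (fun i : ↥Λ₀ => (L i).subgroupOf Q) XQ RQ))) := by
  obtain ⟨C, hR, hL, hQ, hQ'⟩ := exists_core hpres
  have hfin := C.isFiniteRelPres hpres hR hQ'
  refine ⟨C.idx, C.bijective_lift_base hpres hR hQ', fun i => C.L i.1, C.Q,
    fun i => C.L_le_H i.1, fun i => C.L_le_Q i.1, fun i => hL i.1, hQ, C.Q_le_base hQ',
    C.nonempty_base_mulEquiv hpres hR hQ', ⟨C.XQ, _, hfin⟩, fun hD => ?_⟩
  have hDQ := C.dehnWellDefined hR hpres hD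
  exact ⟨C.XQ, C.emb ⁻¹' R, hfin, hDQ,
    ⟨1, 1, 0, fun n => by simpa using C.relDehn_le_relDehn hR hpres hD n⟩,
    ⟨1, 1, 0, fun n => by simpa using C.relDehn_le_subnegClosure hR hpres hDQ n⟩⟩
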